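/- For p ≥ 2, define F_p : ℝ^{2×2} → [0,∞) by F_p(A) = (max{a,0}·max{d,0} + ½(b² + c²))^{p/2} for A = [[a,b],[c,d]]. Then F_p is not polyconvex at the identity matrix Id: there is no convex function G : ℝ^{2×2} × ℝ → ℝ with G(Id, det Id) = F_p(Id) and G(A, det A) ≤ F_p(A) for every A ∈ ℝ^{2×2}. (Indeed, with A₁ = diag(−3,−3), A₂ = diag(9,−3), A₃ = diag(−3,9), one has Id = (A₁+A₂+A₃)/3 and det Id = (det A₁ + det A₂ + det A₃)/3, yet F_p(Id) = 1 > 0 = (F_p(A₁)+F_p(A₂)+F_p(A₃))/3.) -/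

import Mathlib

open Matrix MeasureTheory Set

/-- The operator norm `|A| = max_{|ξ|=1} |Aξ|` of a square matrix, computed via the
Euclidean spaces. -/
noncomputable def opNorm {n : ℕ} (A : Matrix (Fin n) (Fin n) ℝ) : ℝ :=
  ‖LinearMap.toContinuousLinearMap (Matrix.toEuclideanLin A)‖

/-- `F` is rank-one convex: `t ↦ F (A + t • X)` is convex whenever `rank X = 1`. -/
def RankOneConvex {n : ℕ} (F : Matrix (Fin n) (Fin n) ℝ → ℝ) : Prop :=
  ∀ A X : Matrix (Fin n) (Fin n) ℝ, X.rank = 1 →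
    ConvexOn ℝ Set.univ (fun t : ℝ => F (A + t • X))

/-- `F` is isotropic: `F (Q * A * R) = F A` for all `Q, R ∈ SO(n)`. -/
def Isotropic {n : ℕ} (F : Matrix (Fin n) (Fin n) ℝ → ℝ) : Prop :=
  ∀ (A Q R : Matrix (Fin n) (Fin n) ℝ),
    Qᵀ * Q = 1 → Q.det = 1 → Rᵀ * R = 1 → R.det = 1 → F (Q * A * R) = F A

/-- `F` is positively `p`-homogeneous: `F (t • A) = t ^ p * F A` for `t > 0`. -/
def PosHomogeneous {n : ℕ} (p : ℝ) (F : Matrix (Fin n) (Fin n) ℝ → ℝ) : Prop :=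
  ∀ (A : Matrix (Fin n) (Fin n) ℝ) (t : ℝ), 0 < t → F (t • A) = t ^ p * F A

/-- The set `CO(n) = {t • Q : Q ∈ O(n), t ∈ ℝ}` of conformal matrices. -/
def ConformalSet (n : ℕ) : Set (Matrix (Fin n) (Fin n) ℝ) :=
  {A | ∃ (t : ℝ) (Q : Matrix (Fin n) (Fin n) ℝ), Qᵀ * Q = 1 ∧ A = t • Q}

/-- The matrix `Īd = diag(1, …, 1, -1)`. -/
noncomputable def Ibar (n : ℕ) : Matrix (Fin n) (Fin n) ℝ :=
  Matrix.diagonal (fun i => if (i : ℕ) = n - 1 then -1 else 1)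

/-- The integrand `F_p(A) = (max(a,0)·max(d,0) + (b² + c²)/2)^(p/2)`. -/
noncomputable def Fp (p : ℝ) (A : Matrix (Fin 2) (Fin 2) ℝ) : ℝ :=
  (max (A 0 0) 0 * max (A 1 1) 0 + (A 0 1 ^ 2 + A 1 0 ^ 2) / 2) ^ (p / 2)

/-- For `p ≥ 2`, the integrand `F_p` is not polyconvex at `Id`: there is
no convex `G : ℝ^{2×2} × ℝ → ℝ` with `G(Id, det Id) = F_p(Id)` and
`G(A, det A) ≤ F_p(A)` for all `A`. -/
theorem stmt_8 (p : ℝ) (hp : 2 ≤ p) :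
    ¬ ∃ G : Matrix (Fin 2) (Fin 2) ℝ × ℝ → ℝ,
        ConvexOn ℝ Set.univ G ∧
        G (1, Matrix.det (1 : Matrix (Fin 2) (Fin 2) ℝ)) = Fp p 1 ∧
        ∀ A : Matrix (Fin 2) (Fin 2) ℝ, G (A, A.det) ≤ Fp p A := by
  rintro ⟨G, hG, hone, hle⟩
  -- `Id` and `det Id` are the averages of `diag(-2,-2)`, `diag(4,0)`, `diag(0,4)` and of their
  -- determinants with weights `1/4`, `3/8`, `3/8`, and `F_p` vanishes at these three matrices.
  have hp0 : p / 2 ≠ 0 := by linarith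
  have h₁ : G (!![-2, 0; 0, -2], 4) ≤ 0 := by
    have h := hle !![-2, 0; 0, -2]
    norm_num [Fp, Matrix.det_fin_two, Real.zero_rpow hp0] at h
    exact h
  have h₂ : G (!![4, 0; 0, 0], 0) ≤ 0 := by
    have h := hle !![4, 0; 0, 0]
    norm_num [Fp, Matrix.det_fin_two, Real.zero_rpow hp0] at h
    exact h
  have h₃ : G (!![0, 0; 0, 4], 0) ≤ 0 := by
    have h := hle !![0, 0; 0, 4]
    norm_num [Fp, Matrix.det_fin_two, Real.zero_rpow hp0] at h
    exact h
  have hmid := hG.2 (mem_univ (!![(4 : ℝ), 0; 0, 0], (0 : ℝ)))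
    (mem_univ (!![(0 : ℝ), 0; 0, 4], (0 : ℝ)))
    (by norm_num : (0 : ℝ) ≤ 1 / 2) (by norm_num : (0 : ℝ) ≤ 1 / 2) (by norm_num)
  have hId := hG.2 (mem_univ (!![(-2 : ℝ), 0; 0, -2], (4 : ℝ)))
    (mem_univ (!![(2 : ℝ), 0; 0, 2], (0 : ℝ)))
    (by norm_num : (0 : ℝ) ≤ 1 / 4) (by norm_num : (0 : ℝ) ≤ 3 / 4) (by norm_num)
  have emid : (1 / 2 : ℝ) • (!![(4 : ℝ), 0; 0, 0], (0 : ℝ)) +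
      (1 / 2 : ℝ) • (!![(0 : ℝ), 0; 0, 4], (0 : ℝ)) = (!![2, 0; 0, 2], 0) := by
    ext i j
    · fin_cases i <;> fin_cases j <;> norm_num
    · norm_num
  have eId : (1 / 4 : ℝ) • (!![(-2 : ℝ), 0; 0, -2], (4 : ℝ)) +
      (3 / 4 : ℝ) • (!![(2 : ℝ), 0; 0, 2], (0 : ℝ)) =
      (1, Matrix.det (1 : Matrix (Fin 2) (Fin 2) ℝ)) := by
    ext i j
    · fin_cases i <;> fin_cases j <;> norm_num
    · norm_num
  have hF : Fp p 1 = 1 := by simp [Fp]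
  rw [emid] at hmid
  rw [eId, hone, hF] at hId
  simp only [smul_eq_mul] at hmid hId
  linarith
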